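/- For every f in Thompson's group F, c(f) − 3 ≤ ℓ(f) ≤ 4(c(f) − 1). (In terms of the norm ‖f‖ = 2(c(f) − 1) of the reduced strand diagram of f, this says ‖f‖/2 − 2 ≤ ℓ(f) ≤ 2‖f‖.) -/

import Mathlib

noncomputable section

open Set

noncomputable section

open Set

def x0fun : ℝ → ℝ := fun t =>
  if t < 0 then t
  else if t ≤ 1/2 then t / 2
  else if t ≤ 3/4 then t - 1/4
  else if t ≤ 1 then 2 * t - 1
  else t

def x0inv : ℝ → ℝ := fun t =>
  if t < 0 then t
  else if t ≤ 1/4 then 2 * t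
  else if t ≤ 1/2 then t + 1/4
  else if t ≤ 1 then (t + 1) / 2
  else t

/-- The generator `x₀` of Thompson's group `F`, as a permutation of `ℝ`
(the identity outside `[0,1]`). -/
def x0 : Equiv.Perm ℝ where
  toFun := x0fun
  invFun := x0inv
  left_inv := by
    intro t
    show x0inv (x0fun t) = t
    unfold x0fun
    split_ifs <;> (unfold x0inv; split_ifs <;> linarith)
  right_inv := by
    intro t
    show x0fun (x0inv t) = t
    unfold x0inv
    split_ifs <;> (unfold x0fun; split_ifs <;> linarith)

def x1fun : ℝ → ℝ := fun t =>
  if t < 0 then t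
  else if t ≤ 1/2 then t
  else if t ≤ 3/4 then t / 2 + 1/4
  else if t ≤ 7/8 then t - 1/8
  else if t ≤ 1 then 2 * t - 1
  else t

def x1inv : ℝ → ℝ := fun t =>
  if t < 0 then t
  else if t ≤ 1/2 then t
  else if t ≤ 5/8 then 2 * t - 1/2
  else if t ≤ 3/4 then t + 1/8
  else if t ≤ 1 then (t + 1) / 2
  else t

set_option maxHeartbeats 2000000 in
/-- The generator `x₁` of Thompson's group `F`, as a permutation of `ℝ`
(the identity outside `[0,1]`). -/
def x1 : Equiv.Perm ℝ where
  toFun := x1fun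
  invFun := x1inv
  left_inv := by
    intro t
    show x1inv (x1fun t) = t
    unfold x1fun
    split_ifs <;> (unfold x1inv; split_ifs <;> linarith)
  right_inv := by
    intro t
    show x1fun (x1inv t) = t
    unfold x1inv
    split_ifs <;> (unfold x1fun; split_ifs <;> linarith)

/-- Thompson's group `F`: the subgroup generated by `x₀` and `x₁`. -/
def ThompsonF : Subgroup (Equiv.Perm ℝ) :=
  Subgroup.closure ({x0, x1} : Set (Equiv.Perm ℝ))

/-- Word length with respect to the generating set `{x₀, x₁}`. -/
def wordLength (f : Equiv.Perm ℝ) : ℕ :=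
  sInf {n | ∃ w : List (Equiv.Perm ℝ), w.length = n ∧
    (∀ g ∈ w, g ∈ ({x0, x1, x0⁻¹, x1⁻¹} : Set (Equiv.Perm ℝ))) ∧ w.prod = f}
/-- `a` and `b` are the endpoints of a standard dyadic interval `[k/2^m, (k+1)/2^m]`. -/
def IsStdDyadicPair (a b : ℝ) : Prop :=
  ∃ k m : ℕ, a = (k : ℝ) / 2 ^ m ∧ b = ((k : ℝ) + 1) / 2 ^ m

/-- `breakCount f` is `c(f)`: the least `N ≥ 1` such that there are partitions
`0 = a₀ < ⋯ < a_N = 1` and `0 = b₀ < ⋯ < b_N = 1` of `[0,1]` into standard dyadic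
intervals with `f` mapping each `[a_{i−1}, a_i]` affinely (increasingly) onto `[b_{i−1}, b_i]`. -/
def breakCount (f : Equiv.Perm ℝ) : ℕ :=
  sInf {N | 1 ≤ N ∧ ∃ a b : Fin (N + 1) → ℝ,
    a 0 = 0 ∧ a (Fin.last N) = 1 ∧ b 0 = 0 ∧ b (Fin.last N) = 1 ∧
    StrictMono a ∧ StrictMono b ∧
    ∀ i : Fin N, IsStdDyadicPair (a i.castSucc) (a i.succ) ∧
      IsStdDyadicPair (b i.castSucc) (b i.succ) ∧
      ∃ c d : ℝ, 0 < c ∧ (∀ t ∈ Set.Icc (a i.castSucc) (a i.succ), f t = c * t + d) ∧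
        c * a i.castSucc + d = b i.castSucc ∧ c * a i.succ + d = b i.succ}


/-- `f` maps the interval `I` affinely and increasingly onto the interval `J`. -/
def AffineOnto (f : Equiv.Perm ℝ) (I J : ℝ × ℝ) : Prop :=
  ∃ c d : ℝ, 0 < c ∧ (∀ t ∈ Set.Icc I.1 I.2, f t = c * t + d) ∧
    c * I.1 + d = J.1 ∧ c * I.2 + d = J.2

namespace AffineOnto

variable {f g : Equiv.Perm ℝ} {I J K : ℝ × ℝ}

lemma one (I : ℝ × ℝ) : AffineOnto 1 I I :=
  ⟨1, 0, one_pos, by simp, by simp, by simp⟩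

lemma mul (hg : AffineOnto g J K) (hf : AffineOnto f I J) : AffineOnto (g * f) I K := by
  obtain ⟨c, d, hc, hfI, h1, h2⟩ := hf
  obtain ⟨c', d', hc', hgJ, h1', h2'⟩ := hg
  refine ⟨c' * c, c' * d + d', mul_pos hc' hc, fun t ht => ?_, ?_, ?_⟩
  · rw [Equiv.Perm.mul_apply, hfI t ht, hgJ]
    · ring
    · rw [← h1, ← h2]
      constructor
      · nlinarith [ht.1]
      · nlinarith [ht.2]
  · rw [← h1', ← h1]; ring
  · rw [← h2', ← h2]; ring

lemma inv (hf : AffineOnto f I J) : AffineOnto f⁻¹ J I := by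
  obtain ⟨c, d, hc, hfI, h1, h2⟩ := hf
  refine ⟨c⁻¹, -(d / c), inv_pos.2 hc, fun t ht => ?_, ?_, ?_⟩
  · rw [Equiv.Perm.inv_eq_iff_eq]
    rw [← h1, ← h2] at ht
    have hst : c * (c⁻¹ * t + -(d / c)) + d = t := by field_simp; ring
    have hmem : c⁻¹ * t + -(d / c) ∈ Set.Icc I.1 I.2 := by
      constructor
      · refine le_of_mul_le_mul_left ?_ hc
        linarith [ht.1]
      · refine le_of_mul_le_mul_left ?_ hc
        linarith [ht.2]
    rw [hfI _ hmem, hst]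
  · rw [← h1]; field_simp; ring
  · rw [← h2]; field_simp; ring

lemma apply_eq (hf : AffineOnto f I J) (hg : AffineOnto g I J) (hI : I.1 < I.2)
    {t : ℝ} (ht : t ∈ Set.Icc I.1 I.2) : f t = g t := by
  obtain ⟨c, d, -, hfI, h1, h2⟩ := hf
  obtain ⟨c', d', -, hgI, h1', h2'⟩ := hg
  have hcc : c = c' := by
    have h : (c - c') * (I.2 - I.1) = 0 := by linarith
    rcases mul_eq_zero.1 h with h | h <;> linarith
  subst hcc
  rw [hfI t ht, hgI t ht]
  linarith

lemma left_half {l r l' r' : ℝ} (h : AffineOnto f (l, r) (l', r')) (hlr : l ≤ r) :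
    AffineOnto f (l, (l + r) / 2) (l', (l' + r') / 2) := by
  obtain ⟨c, d, hc, hf, h1, h2⟩ := h
  refine ⟨c, d, hc, fun t ht => hf t ⟨ht.1, ?_⟩, h1, ?_⟩
  · have := ht.2
    dsimp only at this ⊢
    linarith
  · dsimp only at h1 h2 ⊢
    linarith

lemma right_half {l r l' r' : ℝ} (h : AffineOnto f (l, r) (l', r')) (hlr : l ≤ r) :
    AffineOnto f ((l + r) / 2, r) ((l' + r') / 2, r') := by
  obtain ⟨c, d, hc, hf, h1, h2⟩ := h
  refine ⟨c, d, hc, fun t ht => hf t ⟨?_, ht.2⟩, ?_, h2⟩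
  · have := ht.1
    dsimp only at this ⊢
    linarith
  · dsimp only at h1 h2 ⊢
    linarith

end AffineOnto

/-- `L` lists the successive intervals of a partition of `[l, r]` into standard dyadic
intervals. -/
def IsDyadicChain : ℝ → List (ℝ × ℝ) → ℝ → Prop
  | l, [], r => l = r
  | l, I :: L, r => I.1 = l ∧ I.1 < I.2 ∧ IsStdDyadicPair I.1 I.2 ∧ IsDyadicChain I.2 L r

lemma IsStdDyadicPair.lt {a b : ℝ} (h : IsStdDyadicPair a b) : a < b := by
  obtain ⟨k, m, rfl, rfl⟩ := h
  gcongr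
  linarith

lemma IsStdDyadicPair.left_half {a b : ℝ} (h : IsStdDyadicPair a b) :
    IsStdDyadicPair a ((a + b) / 2) := by
  obtain ⟨k, m, rfl, rfl⟩ := h
  refine ⟨2 * k, m + 1, ?_, ?_⟩ <;> push_cast <;> rw [pow_succ] <;> field_simp
  ring

lemma IsStdDyadicPair.right_half {a b : ℝ} (h : IsStdDyadicPair a b) :
    IsStdDyadicPair ((a + b) / 2) b := by
  obtain ⟨k, m, rfl, rfl⟩ := h
  refine ⟨2 * k + 1, m + 1, ?_, ?_⟩ <;> push_cast <;> rw [pow_succ] <;> field_simp <;> ring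

lemma isStdDyadicPair_zero_one : IsStdDyadicPair 0 1 := ⟨0, 0, by simp, by simp⟩

/-- A standard dyadic interval inside `[l, r]` which contains the midpoint of `[l, r]` in its
interior is the whole of `[l, r]`. -/
lemma IsStdDyadicPair.eq_of_midpoint_mem {l r a b : ℝ} (h : IsStdDyadicPair l r)
    (hab : IsStdDyadicPair a b) (hla : l ≤ a) (hbr : b ≤ r) (ha : a < (l + r) / 2)
    (hb : (l + r) / 2 < b) : a = l ∧ b = r := by
  obtain ⟨k, m, rfl, rfl⟩ := h
  obtain ⟨j, p, rfl, rfl⟩ := hab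
  rcases le_or_gt p m with hpm | hpm
  · have hle : (1 : ℝ) / 2 ^ m ≤ 1 / 2 ^ p :=
      one_div_le_one_div_of_le (by positivity) (pow_le_pow_right₀ (by norm_num) hpm)
    simp only [add_div] at *
    constructor <;> linarith
  · exfalso
    obtain ⟨q, rfl⟩ := Nat.exists_eq_add_of_lt hpm
    have hmid : ((k : ℝ) / 2 ^ m + (k + 1) / 2 ^ m) / 2 =
        ((2 * k + 1) * 2 ^ q) / 2 ^ (m + q + 1) := by
      rw [pow_succ, pow_add]; field_simp; ring
    rw [hmid, div_lt_div_iff_of_pos_right (by positivity)] at ha hb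
    have ha' : j < (2 * k + 1) * 2 ^ q := by exact_mod_cast ha
    have hb' : (2 * k + 1) * 2 ^ q < j + 1 := by exact_mod_cast hb
    omega

namespace IsDyadicChain

lemma append {l m r : ℝ} {L M : List (ℝ × ℝ)} (hL : IsDyadicChain l L m)
    (hM : IsDyadicChain m M r) : IsDyadicChain l (L ++ M) r := by
  induction L generalizing l with
  | nil => obtain rfl : l = m := hL; exact hM
  | cons I L ih => exact ⟨hL.1, hL.2.1, hL.2.2.1, ih hL.2.2.2⟩

lemma le {l r : ℝ} {L : List (ℝ × ℝ)} (h : IsDyadicChain l L r) : l ≤ r := by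
  induction L generalizing l with
  | nil => exact le_of_eq h
  | cons I L ih => exact h.1 ▸ h.2.1.le.trans (ih h.2.2.2)

lemma eq_nil {l : ℝ} {L : List (ℝ × ℝ)} (h : IsDyadicChain l L l) : L = [] := by
  cases L with
  | nil => rfl
  | cons I L =>
    have := h.2.2.2.le
    have := h.1
    have := h.2.1
    linarith

lemma ne_nil {l r : ℝ} {L : List (ℝ × ℝ)} (h : IsDyadicChain l L r) (hlr : l < r) : L ≠ [] := by
  rintro rfl
  exact hlr.ne h

lemma bounds {l r : ℝ} {L : List (ℝ × ℝ)} (h : IsDyadicChain l L r) {I : ℝ × ℝ} (hI : I ∈ L) :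
    l ≤ I.1 ∧ I.2 ≤ r ∧ IsStdDyadicPair I.1 I.2 := by
  induction L generalizing l with
  | nil => simp at hI
  | cons J L ih =>
    rcases List.mem_cons.1 hI with rfl | hI
    · exact ⟨h.1.ge, h.2.2.2.le, h.2.2.1⟩
    · obtain ⟨h1, h2, h3⟩ := ih h.2.2.2 hI
      exact ⟨(h.1 ▸ h.2.1.le).trans h1, h2, h3⟩

lemma eq_singleton {l r : ℝ} {L : List (ℝ × ℝ)} (h : IsDyadicChain l L r) (hI : (l, r) ∈ L) :
    L = [(l, r)] := by
  cases L with
  | nil => simp at hI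
  | cons J L =>
    rcases List.mem_cons.1 hI with hJ | hI
    · subst hJ
      rw [h.2.2.2.eq_nil]
    · have h1 := (h.2.2.2.bounds hI).1
      have h2 := h.1
      have h3 := h.2.1
      dsimp only at h1
      linarith

lemma split {l r m : ℝ} {L : List (ℝ × ℝ)} (h : IsDyadicChain l L r) (hlm : l ≤ m)
    (hmr : m ≤ r) :
    (∃ L₁ L₂, L = L₁ ++ L₂ ∧ IsDyadicChain l L₁ m ∧ IsDyadicChain m L₂ r) ∨
      ∃ I ∈ L, I.1 < m ∧ m < I.2 := by
  induction L generalizing l with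
  | nil =>
    obtain rfl : l = r := h
    exact Or.inl ⟨[], [], rfl, le_antisymm hlm hmr, le_antisymm hmr hlm⟩
  | cons I L ih =>
    obtain ⟨rfl, h2, h3, h4⟩ := h
    rcases le_or_gt I.2 m with hm | hm
    · rcases ih h4 hm with ⟨L₁, L₂, rfl, h5, h6⟩ | ⟨J, hJ, h5⟩
      · exact Or.inl ⟨I :: L₁, L₂, rfl, ⟨rfl, h2, h3, h5⟩, h6⟩
      · exact Or.inr ⟨J, List.mem_cons_of_mem _ hJ, h5⟩
    · rcases hlm.lt_or_eq with hlt | rfl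
      · exact Or.inr ⟨I, List.mem_cons_self, hlt, hm⟩
      · exact Or.inl ⟨[], I :: L, rfl, rfl, ⟨rfl, h2, h3, h4⟩⟩

lemma exists_mem {l r t : ℝ} {L : List (ℝ × ℝ)} (h : IsDyadicChain l L r) (hlr : l < r)
    (ht : t ∈ Set.Icc l r) : ∃ I ∈ L, t ∈ Set.Icc I.1 I.2 := by
  induction L generalizing l with
  | nil => exact absurd h hlr.ne
  | cons I L ih =>
    obtain ⟨rfl, h2, h3, h4⟩ := h
    rcases le_or_gt t I.2 with hm | hm
    · exact ⟨I, List.mem_cons_self, ht.1, hm⟩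
    · obtain ⟨J, hJ, h5⟩ := ih h4 (hm.trans_le ht.2) ⟨hm.le, ht.2⟩
      exact ⟨J, List.mem_cons_of_mem _ hJ, h5⟩

/-- Halving one interval of a dyadic partition. -/
lemma refine_at {l r : ℝ} {I : ℝ × ℝ} {L M : List (ℝ × ℝ)}
    (h : IsDyadicChain l (L ++ I :: M) r) :
    IsDyadicChain l (L ++ (I.1, (I.1 + I.2) / 2) :: ((I.1 + I.2) / 2, I.2) :: M) r := by
  induction L generalizing l with
  | nil =>
    obtain ⟨h1, -, h3, h4⟩ := h
    exact ⟨h1, h3.left_half.lt, h3.left_half, rfl, h3.right_half.lt, h3.right_half, h4⟩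
  | cons J L ih => exact ⟨h.1, h.2.1, h.2.2.1, ih h.2.2.2⟩

end IsDyadicChain

/-- `f` maps a partition of `[0,1]` into `N` standard dyadic intervals, interval by interval,
affinely onto another such partition. -/
def HasDyadicPair (f : Equiv.Perm ℝ) (N : ℕ) : Prop :=
  ∃ L M : List (ℝ × ℝ), L.length = N ∧ IsDyadicChain 0 L 1 ∧ IsDyadicChain 0 M 1 ∧
    List.Forall₂ (AffineOnto f) L M

lemma isDyadicChain_ofFn {N : ℕ} (a : Fin (N + 1) → ℝ)
    (h : ∀ i : Fin N, IsStdDyadicPair (a i.castSucc) (a i.succ)) :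
    IsDyadicChain (a 0) (List.ofFn fun i : Fin N => (a i.castSucc, a i.succ))
      (a (Fin.last N)) := by
  induction N with
  | zero => rfl
  | succ N ih =>
    rw [List.ofFn_succ]
    exact ⟨rfl, (h 0).lt, h 0, ih (fun i => a i.succ) fun i => h i.succ⟩

lemma forall₂_ofFn {α β : Type*} {R : α → β → Prop} {N : ℕ} {u : Fin N → α} {v : Fin N → β}
    (h : ∀ i, R (u i) (v i)) : List.Forall₂ R (List.ofFn u) (List.ofFn v) := by
  induction N with
  | zero => simp
  | succ N ih =>
    rw [List.ofFn_succ, List.ofFn_succ]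
    exact List.Forall₂.cons (h 0) (ih fun i => h i.succ)

lemma exists_fin_of_forall₂ {f : Equiv.Perm ℝ} {L M : List (ℝ × ℝ)} {l r l' r' : ℝ}
    (hL : IsDyadicChain l L r) (hM : IsDyadicChain l' M r')
    (hLM : List.Forall₂ (AffineOnto f) L M) :
    ∃ a b : Fin (L.length + 1) → ℝ, a 0 = l ∧ a (Fin.last _) = r ∧ b 0 = l' ∧
      b (Fin.last _) = r' ∧ ∀ i : Fin L.length, IsStdDyadicPair (a i.castSucc) (a i.succ) ∧
        IsStdDyadicPair (b i.castSucc) (b i.succ) ∧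
        AffineOnto f (a i.castSucc, a i.succ) (b i.castSucc, b i.succ) := by
  induction hLM generalizing l l' with
  | nil => exact ⟨fun _ => l, fun _ => l', rfl, hL, rfl, hM, fun i => i.elim0⟩
  | @cons I J L M hIJ _ ih =>
    obtain ⟨rfl, -, hI, hL⟩ := hL
    obtain ⟨rfl, -, hJ, hM⟩ := hM
    obtain ⟨a, b, ha, har, hb, hbr, h⟩ := ih hL hM
    refine ⟨Fin.cons I.1 a, Fin.cons J.1 b, rfl, har, rfl, hbr, fun i => ?_⟩
    refine Fin.cases ?_ (fun i => ?_) i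
    · change IsStdDyadicPair I.1 (a 0) ∧ IsStdDyadicPair J.1 (b 0) ∧
        AffineOnto f (I.1, a 0) (J.1, b 0)
      rw [ha, hb]
      exact ⟨hI, hJ, hIJ⟩
    · exact h i

lemma breakCount_eq (f : Equiv.Perm ℝ) : breakCount f = sInf {N | HasDyadicPair f N} := by
  unfold breakCount
  congr 1
  ext N
  constructor
  · rintro ⟨-, a, b, ha, ha', hb, hb', -, -, h⟩
    refine ⟨List.ofFn fun i : Fin N => (a i.castSucc, a i.succ),
      List.ofFn fun i : Fin N => (b i.castSucc, b i.succ), by simp, ?_, ?_,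
      forall₂_ofFn fun i => (h i).2.2⟩
    · simpa only [ha, ha'] using isDyadicChain_ofFn a fun i => (h i).1
    · simpa only [hb, hb'] using isDyadicChain_ofFn b fun i => (h i).2.1
  · rintro ⟨L, M, rfl, hL, hM, hLM⟩
    obtain ⟨a, b, ha, ha', hb, hb', h⟩ := exists_fin_of_forall₂ hL hM hLM
    exact ⟨List.length_pos_iff.2 (hL.ne_nil one_pos), a, b, ha, ha', hb, hb',
      Fin.strictMono_iff_lt_succ.2 fun i => (h i).1.lt,
      Fin.strictMono_iff_lt_succ.2 fun i => (h i).2.1.lt, h⟩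

/-- Finite rooted binary trees, which encode the dyadic subdivisions of an interval. -/
inductive DyadicTree
  | leaf : DyadicTree
  | node : DyadicTree → DyadicTree → DyadicTree

namespace DyadicTree

/-- The intervals of the subdivision of `[l, r]` encoded by a tree. -/
def leaves : DyadicTree → ℝ → ℝ → List (ℝ × ℝ)
  | leaf, l, r => [(l, r)]
  | node A B, l, r => A.leaves l ((l + r) / 2) ++ B.leaves ((l + r) / 2) r

/-- The number of carets (interior vertices) of a tree. -/
def carets : DyadicTree → ℕ
  | leaf => 0
  | node A B => A.carets + B.carets + 1

lemma length_leaves (T : DyadicTree) (l r : ℝ) : (T.leaves l r).length = T.carets + 1 := by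
  induction T generalizing l r with
  | leaf => rfl
  | node A B ihA ihB => simp only [leaves, List.length_append, ihA, ihB, carets]; omega

lemma isDyadicChain_leaves (T : DyadicTree) {l r : ℝ} (h : IsStdDyadicPair l r) :
    IsDyadicChain l (T.leaves l r) r := by
  induction T generalizing l r with
  | leaf => exact ⟨rfl, h.lt, h, rfl⟩
  | node A B ihA ihB => exact (ihA h.left_half).append (ihB h.right_half)

/-- Every partition of a standard dyadic interval into standard dyadic intervals comes from
a tree. -/
lemma exists_leaves_eq {l r : ℝ} (h : IsStdDyadicPair l r) {L : List (ℝ × ℝ)}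
    (hL : IsDyadicChain l L r) : ∃ T : DyadicTree, T.leaves l r = L := by
  induction hn : L.length using Nat.strong_induction_on generalizing l r L with
  | _ n ih =>
    subst hn
    have hl := h.left_half.lt
    have hr := h.right_half.lt
    rcases hL.split hl.le hr.le with ⟨L₁, L₂, rfl, h₁, h₂⟩ | ⟨I, hI, hm, hm'⟩
    · have p₁ := List.length_pos_iff.2 (h₁.ne_nil hl)
      have p₂ := List.length_pos_iff.2 (h₂.ne_nil hr)
      obtain ⟨A, rfl⟩ := ih _ (by rw [List.length_append]; omega) h.left_half h₁ rfl
      obtain ⟨B, rfl⟩ := ih _ (by rw [List.length_append]; omega) h.right_half h₂ rfl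
      exact ⟨node A B, rfl⟩
    · obtain ⟨b₁, b₂, b₃⟩ := hL.bounds hI
      obtain ⟨e₁, e₂⟩ := h.eq_of_midpoint_mem b₃ b₁ b₂ hm hm'
      have hI' : (l, r) ∈ L := by rwa [← e₁, ← e₂]
      exact ⟨leaf, (hL.eq_singleton hI').symm⟩

lemma forall₂_leaves {f : Equiv.Perm ℝ} (T : DyadicTree) {l r l' r' : ℝ} (hlr : l ≤ r)
    (h : AffineOnto f (l, r) (l', r')) :
    List.Forall₂ (AffineOnto f) (T.leaves l r) (T.leaves l' r') := by
  induction T generalizing l r l' r' with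
  | leaf => exact List.Forall₂.cons h List.Forall₂.nil
  | node A B ihA ihB =>
    exact List.rel_append (ihA (by linarith) (h.left_half hlr))
      (ihB (by linarith) (h.right_half hlr))

end DyadicTree

open DyadicTree

/-- `f` maps the leaf intervals of `T` in `[0,1]` affinely onto those of `S`, in order. -/
def Carries (f : Equiv.Perm ℝ) (T S : DyadicTree) : Prop :=
  List.Forall₂ (AffineOnto f) (T.leaves 0 1) (S.leaves 0 1)

lemma forall₂_affineOnto_mul {f g : Equiv.Perm ℝ} {L M K : List (ℝ × ℝ)}
    (hf : List.Forall₂ (AffineOnto f) L M) (hg : List.Forall₂ (AffineOnto g) M K) :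
    List.Forall₂ (AffineOnto (g * f)) L K := by
  induction hf generalizing K with
  | nil => cases hg; exact List.Forall₂.nil
  | cons h _ ih =>
    cases hg with
    | cons h' hg => exact List.Forall₂.cons (h'.mul h) (ih hg)

namespace Carries

variable {f g : Equiv.Perm ℝ} {T S R : DyadicTree}

lemma one (T : DyadicTree) : Carries 1 T T :=
  List.forall₂_same.2 fun I _ => AffineOnto.one I

lemma mul (hg : Carries g S R) (hf : Carries f T S) : Carries (g * f) T R :=
  forall₂_affineOnto_mul hf hg

lemma inv (hf : Carries f T S) : Carries f⁻¹ S T :=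
  List.Forall₂.flip (hf.imp fun _ _ h => h.inv)

lemma apply_eq (hf : Carries f T S) (hg : Carries g T S) {t : ℝ} (ht : t ∈ Set.Icc (0 : ℝ) 1) :
    f t = g t := by
  have hT := T.isDyadicChain_leaves isStdDyadicPair_zero_one
  obtain ⟨I, hI, htI⟩ := hT.exists_mem one_pos ht
  unfold Carries at hf hg
  generalize T.leaves 0 1 = L at *
  generalize S.leaves 0 1 = M at *
  have hlt := (hT.bounds hI).2.2.lt
  clear hT
  induction hf with
  | nil => simp at hI
  | cons h _ ih =>
    cases hg with
    | cons h' hg =>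
      rcases List.mem_cons.1 hI with rfl | hI
      · exact h.apply_eq h' hlt htI
      · exact ih hI hg

end Carries

lemma carries_x0 (A B C : DyadicTree) : Carries x0 (node A (node B C)) (node (node A B) C) := by
  have e : ∀ t, x0 t = x0fun t := fun _ => rfl
  simp only [Carries, leaves, List.append_assoc]
  refine List.rel_append (forall₂_leaves A (by norm_num) ⟨1 / 2, 0, ?_, ?_, ?_, ?_⟩)
    (List.rel_append (forall₂_leaves B (by norm_num) ⟨1, -(1 / 4), ?_, ?_, ?_, ?_⟩)
      (forall₂_leaves C (by norm_num) ⟨2, -1, ?_, ?_, ?_, ?_⟩))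
  all_goals try norm_num
  all_goals
    intro t h1 h2
    rw [e, x0fun]
    split_ifs <;> linarith

lemma carries_x1 (A B C D : DyadicTree) :
    Carries x1 (node A (node B (node C D))) (node A (node (node B C) D)) := by
  have e : ∀ t, x1 t = x1fun t := fun _ => rfl
  simp only [Carries, leaves, List.append_assoc]
  refine List.rel_append (forall₂_leaves A (by norm_num) ⟨1, 0, ?_, ?_, ?_, ?_⟩)
    (List.rel_append (forall₂_leaves B (by norm_num) ⟨1 / 2, 1 / 4, ?_, ?_, ?_, ?_⟩)
      (List.rel_append (forall₂_leaves C (by norm_num) ⟨1, -(1 / 8), ?_, ?_, ?_, ?_⟩)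
        (forall₂_leaves D (by norm_num) ⟨2, -1, ?_, ?_, ?_, ?_⟩)))
  all_goals try norm_num
  all_goals
    intro t h1 h2
    rw [e, x1fun]
    split_ifs <;> linarith

/-- `f` is a product of at most `n` generators and inverses of generators. -/
def IsShortWord (f : Equiv.Perm ℝ) (n : ℕ) : Prop :=
  ∃ w : List (Equiv.Perm ℝ), w.length ≤ n ∧
    (∀ g ∈ w, g ∈ ({x0, x1, x0⁻¹, x1⁻¹} : Set (Equiv.Perm ℝ))) ∧ w.prod = f

namespace IsShortWord

variable {f g : Equiv.Perm ℝ} {m n : ℕ}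

lemma one (n : ℕ) : IsShortWord 1 n := ⟨[], by simp, by simp, rfl⟩

lemma mul_generator (hf : IsShortWord f n)
    (hg : g ∈ ({x0, x1, x0⁻¹, x1⁻¹} : Set (Equiv.Perm ℝ))) : IsShortWord (f * g) (n + 1) := by
  obtain ⟨w, hw, hw', rfl⟩ := hf
  refine ⟨w ++ [g], by simpa using hw, fun x hx => ?_, by simp⟩
  rcases List.mem_append.1 hx with hx | hx
  · exact hw' x hx
  · rwa [List.mem_singleton.1 hx]

lemma mul (hf : IsShortWord f m) (hg : IsShortWord g n) : IsShortWord (f * g) (m + n) := by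
  obtain ⟨w, hw, hw', rfl⟩ := hf
  obtain ⟨v, hv, hv', rfl⟩ := hg
  refine ⟨w ++ v, by rw [List.length_append]; omega, fun x hx => ?_, by simp⟩
  exact (List.mem_append.1 hx).elim (hw' x) (hv' x)

lemma inv (hf : IsShortWord f n) : IsShortWord f⁻¹ n := by
  obtain ⟨w, hw, hw', rfl⟩ := hf
  refine ⟨(w.map fun x => x⁻¹).reverse, by simpa using hw, fun x hx => ?_,
    (List.prod_inv_reverse w).symm⟩
  obtain ⟨y, hy, rfl⟩ := List.mem_map.1 (List.mem_reverse.1 hx)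
  rcases hw' y hy with rfl | rfl | rfl | rfl <;> simp

lemma wordLength_le (hf : IsShortWord f n) : wordLength f ≤ n := by
  obtain ⟨w, hw, hw', h⟩ := hf
  have hle : wordLength f ≤ w.length := Nat.sInf_le ⟨w, rfl, hw', h⟩
  exact hle.trans hw

lemma apply_of_notMem (hf : IsShortWord f n) {t : ℝ} (ht : t ∉ Set.Icc (0 : ℝ) 1) :
    f t = t := by
  have h0 : x0 t = t := by
    change x0fun t = t
    rw [Set.mem_Icc, not_and_or] at ht
    unfold x0fun
    split_ifs <;> grind
  have h1 : x1 t = t := by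
    change x1fun t = t
    rw [Set.mem_Icc, not_and_or] at ht
    unfold x1fun
    split_ifs <;> grind
  obtain ⟨w, -, hw, rfl⟩ := hf
  induction w with
  | nil => rfl
  | cons g w ih =>
    rw [List.prod_cons, Equiv.Perm.mul_apply, ih fun x hx => hw x (List.mem_cons_of_mem _ hx)]
    rcases hw g List.mem_cons_self with rfl | rfl | rfl | rfl
    · exact h0
    · exact h1
    · exact Equiv.Perm.inv_eq_iff_eq.2 h0.symm
    · exact Equiv.Perm.inv_eq_iff_eq.2 h1.symm

end IsShortWord

lemma exists_word_length_eq {f : Equiv.Perm ℝ} (hf : f ∈ ThompsonF) :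
    ∃ w : List (Equiv.Perm ℝ), w.length = wordLength f ∧
      (∀ g ∈ w, g ∈ ({x0, x1, x0⁻¹, x1⁻¹} : Set (Equiv.Perm ℝ))) ∧ w.prod = f := by
  rw [ThompsonF, ← Subgroup.mem_toSubmonoid, Subgroup.closure_toSubmonoid] at hf
  obtain ⟨w, hw, rfl⟩ := Submonoid.exists_list_of_mem_closure hf
  refine Nat.sInf_mem (s := {n | ∃ v : List (Equiv.Perm ℝ), v.length = n ∧
    (∀ g ∈ v, g ∈ ({x0, x1, x0⁻¹, x1⁻¹} : Set (Equiv.Perm ℝ))) ∧ v.prod = w.prod})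
    ⟨w.length, w, rfl, fun g hg => ?_, rfl⟩
  rcases hw g hg with (h | h) | (h | h)
  · simp [h]
  · simp [Set.mem_singleton_iff.1 h]
  · simp [← h]
  · simp [← Set.mem_singleton_iff.1 h]

/-- Halving one of the target intervals of `f`, and the corresponding source interval. -/
lemma exists_refinement {f : Equiv.Perm ℝ} {L M K : List (ℝ × ℝ)} {l r : ℝ}
    (hL : IsDyadicChain 0 L 1) (h : List.Forall₂ (AffineOnto f) L (M ++ (l, r) :: K)) :
    ∃ L' : List (ℝ × ℝ), L'.length = L.length + 1 ∧ IsDyadicChain 0 L' 1 ∧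
      List.Forall₂ (AffineOnto f) L' (M ++ (l, (l + r) / 2) :: ((l + r) / 2, r) :: K) := by
  have hsplit : ∃ L₁ I L₂, L = L₁ ++ I :: L₂ ∧ List.Forall₂ (AffineOnto f) L₁ M ∧
      AffineOnto f I (l, r) ∧ List.Forall₂ (AffineOnto f) L₂ K := by
    clear hL
    induction M generalizing L with
    | nil =>
      cases h with
      | cons hI h => exact ⟨[], _, _, rfl, List.Forall₂.nil, hI, h⟩
    | cons J M ih =>
      cases h with
      | cons hI h =>
        obtain ⟨L₁, I, L₂, rfl, h₁, h₂, h₃⟩ := ih h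
        exact ⟨_ :: L₁, I, L₂, rfl, List.Forall₂.cons hI h₁, h₂, h₃⟩
  obtain ⟨L₁, I, L₂, rfl, h₁, h₂, h₃⟩ := hsplit
  have hI : I.1 ≤ I.2 := (hL.bounds (I := I) (by simp)).2.2.lt.le
  refine ⟨_, ?_, hL.refine_at, List.rel_append h₁
    (List.Forall₂.cons (h₂.left_half hI) (List.Forall₂.cons (h₂.right_half hI) h₃))⟩
  simp only [List.length_append, List.length_cons]
  omega

/-- A product of `n` generators has a dyadic description with at most `n + 3` intervals, whose
target partition refines `[0, 1/2], [1/2, 3/4], [3/4, 1]`. -/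
lemma exists_description_of_word (w : List (Equiv.Perm ℝ))
    (hw : ∀ g ∈ w, g ∈ ({x0, x1, x0⁻¹, x1⁻¹} : Set (Equiv.Perm ℝ))) :
    ∃ (L : List (ℝ × ℝ)) (A B C : DyadicTree), L.length ≤ w.length + 3 ∧ IsDyadicChain 0 L 1 ∧
      List.Forall₂ (AffineOnto w.prod) L ((node A (node B C)).leaves 0 1) := by
  induction w with
  | nil =>
    exact ⟨(node leaf (node leaf leaf)).leaves 0 1, leaf, leaf, leaf,
      by simp [length_leaves, carets], isDyadicChain_leaves _ isStdDyadicPair_zero_one, Carries.one _⟩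
  | cons g w ih =>
    obtain ⟨L, A, B, C, hlen, hL, h⟩ := ih fun x hx => hw x (List.mem_cons_of_mem _ hx)
    rw [List.prod_cons, List.length_cons]
    rcases hw g List.mem_cons_self with rfl | rfl | rfl | rfl
    · cases C with
      | node C D => exact ⟨L, _, _, _, by omega, hL, forall₂_affineOnto_mul h (carries_x0 A B _)⟩
      | leaf =>
        simp only [leaves, ← List.append_assoc] at h
        obtain ⟨L', hlen', hL', href⟩ := exists_refinement hL h
        refine ⟨L', node A B, leaf, leaf, by omega, hL',
          forall₂_affineOnto_mul ?_ (carries_x0 A B (node leaf leaf))⟩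
        simpa only [leaves, List.append_assoc, List.cons_append, List.nil_append] using href
    · cases C with
      | node C D => exact ⟨L, _, _, _, by omega, hL, forall₂_affineOnto_mul h (carries_x1 A B C D)⟩
      | leaf =>
        simp only [leaves, ← List.append_assoc] at h
        obtain ⟨L', hlen', hL', href⟩ := exists_refinement hL h
        refine ⟨L', A, node B leaf, leaf, by omega, hL',
          forall₂_affineOnto_mul ?_ (carries_x1 A B leaf leaf)⟩
        simpa only [leaves, List.append_assoc, List.cons_append, List.nil_append] using href
    · cases A with
      | node A D =>
        exact ⟨L, _, _, _, by omega, hL, forall₂_affineOnto_mul h (carries_x0 A D _).inv⟩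
      | leaf =>
        simp only [leaves, List.cons_append, List.nil_append] at h
        obtain ⟨L', hlen', hL', href⟩ := exists_refinement (M := []) hL h
        refine ⟨L', leaf, leaf, node B C, by omega, hL',
          forall₂_affineOnto_mul ?_ (carries_x0 leaf leaf (node B C)).inv⟩
        simpa only [leaves, List.append_assoc, List.cons_append, List.nil_append] using href
    · cases B with
      | node B D =>
        exact ⟨L, _, _, _, by omega, hL, forall₂_affineOnto_mul h (carries_x1 A B D C).inv⟩
      | leaf =>
        simp only [leaves, List.cons_append, List.nil_append] at h
        obtain ⟨L', hlen', hL', href⟩ := exists_refinement hL h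
        refine ⟨L', A, leaf, node leaf C, by omega, hL',
          forall₂_affineOnto_mul ?_ (carries_x1 A leaf leaf C).inv⟩
        simpa only [leaves, List.append_assoc, List.cons_append, List.nil_append] using href

/-- A product of `n` generators has a dyadic description with at most `n + 3` intervals. -/
lemma exists_hasDyadicPair {f : Equiv.Perm ℝ} (hf : f ∈ ThompsonF) :
    ∃ N ≤ wordLength f + 3, HasDyadicPair f N := by
  obtain ⟨w, hlen, hw, rfl⟩ := exists_word_length_eq hf
  obtain ⟨L, A, B, C, hL, hL', h⟩ := exists_description_of_word w hw
  exact ⟨L.length, hlen ▸ hL, L, _, rfl, hL', isDyadicChain_leaves _ isStdDyadicPair_zero_one, h⟩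

namespace DyadicTree

/-- The left vine obtained by hanging `n + 1` carets above `A`. -/
def vine (A : DyadicTree) : ℕ → DyadicTree
  | 0 => node A leaf
  | n + 1 => vine (node A leaf) n

/-- The number of carets, counting twice those off the right spine. -/
def rightWeight : DyadicTree → ℕ
  | leaf => 0
  | node A B => 2 * A.carets + B.rightWeight + 1

lemma rightWeight_le (T : DyadicTree) : T.rightWeight ≤ 2 * T.carets := by
  induction T with
  | leaf => rfl
  | node A B _ ihB => simp only [rightWeight, carets]; omega

end DyadicTree

/-- Combing a tree into a left vine, moving its right branch to the left spine. -/
lemma exists_carries_vine (A Q : DyadicTree) :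
    ∃ u, IsShortWord u Q.rightWeight ∧ Carries u (node A Q) (A.vine Q.carets) := by
  induction hn : Q.rightWeight generalizing A Q with
  | zero =>
    cases Q with
    | leaf => exact ⟨1, IsShortWord.one 0, Carries.one _⟩
    | node B C => simp [rightWeight] at hn
  | succ n ih =>
    cases Q with
    | leaf => simp [rightWeight] at hn
    | node B C =>
      cases B with
      | leaf =>
        obtain ⟨u, hu, hc⟩ := ih (node A leaf) C (by simp only [rightWeight, carets] at hn; omega)
        refine ⟨u * x0, hu.mul_generator (by simp), ?_⟩
        have e : A.vine (node leaf C).carets = (node A leaf).vine C.carets := by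
          simp only [carets, zero_add, vine]
        rw [e]
        exact hc.mul (carries_x0 _ _ _)
      | node B D =>
        obtain ⟨u, hu, hc⟩ := ih A (node B (node D C))
          (by simp only [rightWeight, carets] at hn ⊢; omega)
        refine ⟨u * x1⁻¹, hu.mul_generator (by simp), ?_⟩
        have e : (node (node B D) C).carets = (node B (node D C)).carets := by
          simp only [carets]; omega
        rw [e]
        exact hc.mul (carries_x1 _ _ _ _).inv

/-- Combing an arbitrary nontrivial tree into the left vine with as many carets. -/
lemma exists_carries_leaf_vine (X Q : DyadicTree) :
    ∃ u, IsShortWord u (2 * X.carets + Q.rightWeight) ∧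
      Carries u (node X Q) (leaf.vine (X.carets + Q.carets)) := by
  induction X generalizing Q with
  | leaf => simpa only [carets, mul_zero, zero_add] using exists_carries_vine leaf Q
  | node Y Z ihY _ =>
    obtain ⟨u, hu, hc⟩ := ihY (node Z Q)
    refine ⟨u * x0⁻¹, ?_, ?_⟩
    · have e : 2 * (node Y Z).carets + Q.rightWeight =
          2 * Y.carets + (node Z Q).rightWeight + 1 := by
        simp only [carets, rightWeight]; omega
      rw [e]
      exact hu.mul_generator (by simp)
    · have e : (node Y Z).carets + Q.carets = Y.carets + (node Z Q).carets := by
        simp only [carets]; omega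
      rw [e]
      exact hc.mul (carries_x0 _ _ _).inv

lemma exists_isShortWord_carries {T S : DyadicTree} (h : T.carets = S.carets) :
    ∃ u, IsShortWord u (4 * T.carets) ∧ Carries u T S := by
  cases T with
  | leaf =>
    cases S with
    | leaf => exact ⟨1, IsShortWord.one _, Carries.one _⟩
    | node _ _ => simp [carets] at h
  | node X Q =>
    cases S with
    | leaf => simp [carets] at h
    | node Y R =>
      obtain ⟨u, hu, hu'⟩ := exists_carries_leaf_vine X Q
      obtain ⟨v, hv, hv'⟩ := exists_carries_leaf_vine Y R
      have e : X.carets + Q.carets = Y.carets + R.carets := by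
        simp only [carets] at h; omega
      rw [← e] at hv'
      have hQ := Q.rightWeight_le
      have hR := R.rightWeight_le
      obtain ⟨w, hw, hw'⟩ := hv.inv.mul hu
      exact ⟨v⁻¹ * u, ⟨w, by simp only [carets]; omega, hw'⟩, hv'.inv.mul hu'⟩

lemma wordLength_le_of_hasDyadicPair {f : Equiv.Perm ℝ} (hf : f ∈ ThompsonF) {N : ℕ}
    (h : HasDyadicPair f N) : wordLength f + 4 ≤ 4 * N := by
  obtain ⟨L, M, rfl, hL, hM, hLM⟩ := h
  obtain ⟨T, rfl⟩ := exists_leaves_eq isStdDyadicPair_zero_one hL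
  obtain ⟨S, rfl⟩ := exists_leaves_eq isStdDyadicPair_zero_one hM
  have hlen := hLM.length_eq
  simp only [length_leaves] at hlen
  obtain ⟨u, hu, hc⟩ := exists_isShortWord_carries (Nat.succ_injective hlen)
  have hfu : f = u := by
    ext t
    by_cases ht : t ∈ Set.Icc (0 : ℝ) 1
    · exact Carries.apply_eq hLM hc ht
    · obtain ⟨w, hw, hw', hwf⟩ := exists_word_length_eq hf
      rw [hu.apply_of_notMem ht, IsShortWord.apply_of_notMem ⟨w, hw.le, hw', hwf⟩ ht]
  have := hu.wordLength_le
  rw [length_leaves, hfu]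
  omega

theorem length_vs_breakCount (f : Equiv.Perm ℝ) (hf : f ∈ ThompsonF) :
    (breakCount f : ℤ) - 3 ≤ (wordLength f : ℤ) ∧
    (wordLength f : ℤ) ≤ 4 * ((breakCount f : ℤ) - 1) := by
  obtain ⟨N, hN, hfN⟩ := exists_hasDyadicPair hf
  have hle : breakCount f ≤ N := breakCount_eq f ▸ Nat.sInf_le hfN
  have hmem : HasDyadicPair f (breakCount f) := by
    rw [breakCount_eq]
    exact Nat.sInf_mem (s := {N | HasDyadicPair f N}) ⟨N, hfN⟩
  have := wordLength_le_of_hasDyadicPair hf hmem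
  omega

end
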